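/- Suppose that for every ε ∈ (0, 1/100) and every δ > 0 there exists a constant K = K(ε, δ) > 0 such that for all real X ≥ 1 and all real H with 1 ≤ H ≤ X^{1 − ε}, one has (1/X) ∫_X^{2X} | ∑_{x < m ≤ x+H} μ²(m) − 6H/π² |² dx ≤ K · H^{1/2 + δ}. Then the Riemann Hypothesis holds. -/

import Mathlib

open MeasureTheory

/-- The number of squarefree integers `m` with `x < m ≤ x + H`. -/
noncomputable def sqfShort (x H : ℝ) : ℝ :=
  ∑ m ∈ Finset.Ioc ⌊x⌋₊ ⌊x + H⌋₊, if Squarefree m then (1 : ℝ) else 0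

lemma exists_differentiable_eq_sub_one_mul_riemannZeta :
    ∃ g : ℂ → ℂ, Differentiable ℂ g ∧ ∀ s, s ≠ 1 → g s = (s - 1) * riemannZeta s := by
  refine ⟨DirichletCharacter.LFunctionTrivChar₁ 1,
    DirichletCharacter.differentiable_LFunctionTrivChar₁ 1, fun s hs => ?_⟩
  rw [DirichletCharacter.LFunctionTrivChar₁, Function.update_of_ne hs,
    DirichletCharacter.LFunctionTrivChar, DirichletCharacter.LFunction_modOne_eq]

lemma riemannZeta_one_sub_eq_zero {s : ℂ} (h : riemannZeta s = 0)
    (htriv : ¬ ∃ n : ℕ, s = -2 * (n + 1)) (h1 : s ≠ 1) : riemannZeta (1 - s) = 0 := by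
  have h0 : s ≠ 0 := by
    rintro rfl
    rw [riemannZeta_zero] at h
    norm_num at h
  rw [riemannZeta_def_of_ne_zero h0, div_eq_zero_iff] at h
  rcases h with h | h
  · rw [riemannZeta_def_of_ne_zero (sub_ne_zero.mpr h1.symm), completedRiemannZeta_one_sub, h,
      zero_div]
  · obtain ⟨n, hn⟩ := Complex.Gammaℝ_eq_zero_iff.mp h
    rcases n with _ | n
    · simp at hn
      exact absurd hn h0
    · exact absurd ⟨n, by rw [hn]; push_cast; ring⟩ htriv

/-- Repeatedly halving and reflecting a zero leads to a sequence of zeros converging to `2 / 3`. -/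
lemma riemannZeta_ne_zero_of_half_lt_re (h23 : riemannZeta (2 / 3) ≠ 0)
    (hhalf : ∀ s : ℂ, 1 / 2 < s.re → s ≠ 1 → riemannZeta s = 0 → riemannZeta (s / 2) = 0)
    {s : ℂ} (hs : 1 / 2 < s.re) : riemannZeta s ≠ 0 := by
  intro hz
  have step : ∀ z : ℂ, 1 / 2 < z.re → riemannZeta z = 0 →
      1 / 2 < (1 - z / 2).re ∧ riemannZeta (1 - z / 2) = 0 := by
    intro z hz hz0
    have hlt : z.re < 1 := by
      by_contra! h
      exact riemannZeta_ne_zero_of_one_le_re h hz0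
    have hre : (z / 2).re = z.re / 2 := by simp
    refine ⟨by simp only [Complex.sub_re, hre, Complex.one_re]; linarith, ?_⟩
    have h1 : z ≠ 1 := by rintro rfl; simp at hlt
    refine riemannZeta_one_sub_eq_zero (hhalf z hz h1 hz0) ?_ ?_
    · rintro ⟨n, hn⟩
      have := congrArg Complex.re hn
      simp at this
      have hn0 : (0 : ℝ) ≤ n := n.cast_nonneg
      linarith
    · intro h
      have := congrArg Complex.re h
      simp at this
      linarith
  set u : ℕ → ℂ := fun n => 2 / 3 + (-1 / 2) ^ n * (s - 2 / 3) with hu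
  have hus : ∀ n, u (n + 1) = 1 - u n / 2 := by
    intro n; simp only [hu, pow_succ]; ring
  have hun : ∀ n, 1 / 2 < (u n).re ∧ riemannZeta (u n) = 0 := by
    intro n
    induction n with
    | zero => simpa [hu] using ⟨by simpa using hs, hz⟩
    | succ n ih => rw [hus]; exact step _ ih.1 ih.2
  have hlim : Filter.Tendsto u Filter.atTop (nhds (2 / 3)) := by
    have : Filter.Tendsto (fun n : ℕ => (-1 / 2 : ℂ) ^ n) Filter.atTop (nhds 0) :=
      tendsto_pow_atTop_nhds_zero_of_norm_lt_one (by norm_num)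
    simpa using (this.mul_const (s - 2 / 3)).const_add (2 / 3)
  have hc : ContinuousAt riemannZeta (2 / 3) :=
    (differentiableAt_riemannZeta (by norm_num)).continuousAt
  have := hc.tendsto.comp hlim
  refine h23 (tendsto_nhds_unique this ?_)
  refine tendsto_const_nhds.congr fun n => ?_
  simp [(hun n).2]

lemma riemannHypothesis_of_half_zero (h23 : riemannZeta (2 / 3) ≠ 0)
    (hhalf : ∀ s : ℂ, 1 / 2 < s.re → s ≠ 1 → riemannZeta s = 0 → riemannZeta (s / 2) = 0) :
    RiemannHypothesis := by
  intro s hs htriv h1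
  rcases lt_trichotomy s.re (1 / 2) with h | h | h
  · refine absurd (riemannZeta_one_sub_eq_zero hs htriv h1)
      (riemannZeta_ne_zero_of_half_lt_re h23 hhalf ?_)
    simp only [Complex.sub_re, Complex.one_re]
    linarith
  · exact h
  · exact absurd hs (riemannZeta_ne_zero_of_half_lt_re h23 hhalf h)

lemma LSeries_squarefree_mul_riemannZeta {s : ℂ} (hs : 1 < s.re) :
    LSeries (fun n => ((if Squarefree n then (1 : ℝ) else 0 : ℝ) : ℂ)) s * riemannZeta (2 * s)
      = riemannZeta s := by
  set f : ℕ → ℂ := LSeries.term (fun n => ((if Squarefree n then (1 : ℝ) else 0 : ℝ) : ℂ)) s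
    with hf
  have hs0 : s ≠ 0 := by rintro rfl; simp at hs; linarith
  have hfv : ∀ n : ℕ, f n = if Squarefree n then (n : ℂ) ^ (-s) else 0 := by
    intro n
    rcases eq_or_ne n 0 with rfl | hn
    · simp [hf]
    · rw [hf, LSeries.term_of_ne_zero hn]
      split_ifs <;> simp [Complex.cpow_neg]
  have hsum : Summable (‖f ·‖) := by
    refine (summable_riemannZetaSummand hs).of_nonneg_of_le (fun n => norm_nonneg _) fun n => ?_
    rw [hfv]
    split_ifs
    · exact le_of_eq (by simp [riemannZetaSummandHom])
    · simp
  have hE := EulerProduct.eulerProduct_hasProd (f := f) (by simp [hfv])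
    (fun {m n} hmn => by
      simp only [hfv, Nat.squarefree_mul hmn]
      by_cases hm : Squarefree m <;> by_cases hn : Squarefree n <;>
        simp [hm, hn, Complex.natCast_mul_natCast_cpow]) hsum (by simp [hfv])
  have hpe : ∀ p : Nat.Primes, ∑' e, f ((p : ℕ) ^ e) = 1 + (p : ℂ) ^ (-s) := by
    intro p
    rw [tsum_eq_sum (s := Finset.range 2)]
    · simp [Finset.sum_range_succ, hfv, p.2.prime.squarefree]
    · intro e he
      have he2 : 1 < e := by simpa using he
      rw [hfv, if_neg]
      intro h
      have := (Nat.squarefree_pow_iff p.2.ne_one (by omega)).mp h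
      omega
  simp only [hpe] at hE
  have h2s : 1 < (2 * s).re := by simp; linarith
  have h1 := hE.mul (riemannZeta_eulerProduct_hasProd h2s)
  refine h1.unique ?_
  convert riemannZeta_eulerProduct_hasProd hs using 2 with p
  have hp : (p : ℂ) ^ (-(2 * s)) = ((p : ℂ) ^ (-s)) ^ 2 := by
    rw [← Complex.cpow_nat_mul]
    congr 1
    push_cast
    ring
  have hlt : ‖(p : ℂ) ^ (-s)‖ < 1 := by
    rw [Complex.norm_natCast_cpow_of_pos p.2.pos]
    exact Real.rpow_lt_one_of_one_lt_of_neg (by exact_mod_cast p.2.one_lt)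
      (by rw [Complex.neg_re]; linarith)
  rw [hp]
  set z := (p : ℂ) ^ (-s)
  have hz1 : 1 - z ≠ 0 := by
    intro h
    rw [← sub_eq_zero.mp h] at hlt
    simp at hlt
  have hz2 : 1 + z ≠ 0 := by
    intro h
    rw [eq_neg_of_add_eq_zero_right h] at hlt
    simp at hlt
  have : 1 - z ^ 2 = (1 + z) * (1 - z) := by ring
  rw [this]
  field_simp

lemma differentiableOn_integral_mul_cpow {R : ℝ → ℝ} {σ₀ : ℝ} (hR : Measurable R)
    (hint : ∀ σ, σ₀ < σ → IntegrableOn (fun x => R x * x ^ (-(σ + 1))) (Set.Ioi 1)) :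
    DifferentiableOn ℂ (fun s : ℂ => ∫ x in Set.Ioi (1 : ℝ), (R x : ℂ) * (x : ℂ) ^ (-(s + 1)))
      {s | σ₀ < s.re} := by
  intro s hs
  have hs : σ₀ < s.re := hs
  refine DifferentiableAt.differentiableWithinAt ?_
  obtain ⟨σ₁, h01, h1s⟩ := exists_between hs
  obtain ⟨σ₂, h12, h2s⟩ := exists_between h1s
  have hmeas : ∀ z : ℂ, Measurable fun x : ℝ => (R x : ℂ) * (x : ℂ) ^ (-(z + 1)) := fun z =>
    (Complex.measurable_ofReal.comp hR).mul (Complex.measurable_ofReal.pow_const _)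
  have hnorm : ∀ z : ℂ, ∀ x ∈ Set.Ioi (1 : ℝ),
      ‖(R x : ℂ) * (x : ℂ) ^ (-(z + 1))‖ = |R x| * x ^ (-(z.re + 1)) := by
    intro z x hx
    rw [norm_mul, Complex.norm_real, Real.norm_eq_abs,
      Complex.norm_cpow_eq_rpow_re_of_pos (zero_lt_one.trans hx)]
    simp
  have habs : ∀ σ, σ₀ < σ →
      IntegrableOn (fun x => |R x| * x ^ (-(σ + 1))) (Set.Ioi 1) := by
    intro σ hσ
    refine (hint σ hσ).norm.congr ?_
    filter_upwards [ae_restrict_mem measurableSet_Ioi] with x hx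
    rw [norm_mul, Real.norm_eq_abs, Real.norm_eq_abs,
      abs_of_nonneg (Real.rpow_nonneg (zero_le_one.trans (le_of_lt hx)) _)]
  have key := hasDerivAt_integral_of_dominated_loc_of_deriv_le
    (μ := volume.restrict (Set.Ioi (1 : ℝ)))
    (F := fun (z : ℂ) (x : ℝ) => (R x : ℂ) * (x : ℂ) ^ (-(z + 1)))
    (F' := fun (z : ℂ) (x : ℝ) => (R x : ℂ) * ((x : ℂ) ^ (-(z + 1)) * Complex.log x * (-1)))
    (bound := fun x => (1 / (σ₂ - σ₁)) * (|R x| * x ^ (-(σ₁ + 1))))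
    (s := {z | σ₂ < z.re}) (x₀ := s)
    ((isOpen_lt continuous_const Complex.continuous_re).mem_nhds h2s)
    (Filter.Eventually.of_forall fun z => (hmeas z).aestronglyMeasurable) ?_ ?_ ?_
    ((habs σ₁ h01).const_mul _) ?_
  · exact key.2.differentiableAt
  · refine (integrable_norm_iff (hmeas s).aestronglyMeasurable).mp ?_
    refine (habs s.re hs).congr ?_
    filter_upwards [ae_restrict_mem measurableSet_Ioi] with x hx
    exact (hnorm s x hx).symm
  · refine Measurable.aestronglyMeasurable ?_
    exact (Complex.measurable_ofReal.comp hR).mul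
      (((Complex.measurable_ofReal.pow_const _).mul
        (Complex.measurable_log.comp Complex.measurable_ofReal)).mul_const _)
  · filter_upwards [ae_restrict_mem measurableSet_Ioi] with x hx z hz
    have hx1 : (1 : ℝ) < x := hx
    have hx0 : 0 < x := zero_lt_one.trans hx1
    have hz : σ₂ < z.re := hz
    have hlog := Real.log_le_rpow_div hx0.le (sub_pos.mpr h12)
    rw [← mul_assoc, ← mul_assoc, norm_mul, norm_mul, hnorm z x hx, ← Complex.ofReal_log hx0.le,
      Complex.norm_real, Real.norm_eq_abs, abs_of_nonneg (Real.log_nonneg hx1.le)]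
    simp only [norm_neg, norm_one, mul_one]
    calc |R x| * x ^ (-(z.re + 1)) * Real.log x
        ≤ |R x| * x ^ (-(σ₂ + 1)) * (x ^ (σ₂ - σ₁) / (σ₂ - σ₁)) := by
          gcongr
          · exact Real.log_nonneg hx1.le
          · exact hx1.le
      _ = (1 / (σ₂ - σ₁)) * (|R x| * (x ^ (-(σ₂ + 1)) * x ^ (σ₂ - σ₁))) := by ring
      _ = _ := by rw [← Real.rpow_add hx0]; ring_nf
  · filter_upwards [ae_restrict_mem measurableSet_Ioi] with x hx z hz
    have hx0 : (x : ℂ) ≠ 0 := by exact_mod_cast (zero_lt_one.trans hx).ne'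
    have h1 : HasDerivAt (fun z : ℂ => -(z + 1)) (-1) z := ((hasDerivAt_id z).add_const 1).neg
    exact (h1.const_cpow (Or.inl hx0)).const_mul _

/-- The remainder term in the summatory function of `f`, when the main term is `c * x`. -/
noncomputable def summatoryRemainder (f : ℕ → ℝ) (c x : ℝ) : ℝ :=
  (∑ k ∈ Finset.Icc 1 ⌊x⌋₊, f k) - c * x

lemma monotone_sum_Icc_floor {f : ℕ → ℝ} (hf : ∀ n, 0 ≤ f n) :
    Monotone fun x : ℝ => ∑ k ∈ Finset.Icc 1 ⌊x⌋₊, f k := fun _ _ hxy =>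
  Finset.sum_le_sum_of_subset_of_nonneg
    (Finset.Icc_subset_Icc_right (Nat.floor_le_floor hxy)) fun n _ _ => hf n

lemma measurable_summatoryRemainder {f : ℕ → ℝ} (hf : ∀ n, 0 ≤ f n) (c : ℝ) :
    Measurable (summatoryRemainder f c) :=
  (monotone_sum_Icc_floor hf).measurable.sub (measurable_id.const_mul c)

lemma intervalIntegrable_summatoryRemainder {f : ℕ → ℝ} (hf : ∀ n, 0 ≤ f n) (c a b : ℝ) :
    IntervalIntegrable (summatoryRemainder f c) volume a b :=
  (monotone_sum_Icc_floor hf).intervalIntegrable.sub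
    ((continuous_const_mul c).intervalIntegrable a b)

lemma sub_one_mul_LSeries_eq {f : ℕ → ℝ} {c σ₀ : ℝ} (hf0 : ∀ n, 0 ≤ f n) (hf1 : ∀ n, f n ≤ 1)
    (hσ₀ : σ₀ < 1) (hint : ∀ σ, σ₀ < σ →
      IntegrableOn (fun x => summatoryRemainder f c x * x ^ (-(σ + 1))) (Set.Ioi 1))
    {s : ℂ} (hs : 1 < s.re) :
    (s - 1) * LSeries (fun n => (f n : ℂ)) s = s * (s - 1) *
      (∫ x in Set.Ioi (1 : ℝ), (summatoryRemainder f c x : ℂ) * (x : ℂ) ^ (-(s + 1))) + c * s := by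
  have hO : (fun n : ℕ => ∑ k ∈ Finset.Icc 1 n, f k) =O[Filter.atTop]
      fun n : ℕ => (n : ℝ) ^ (1 : ℝ) := by
    refine Asymptotics.isBigO_of_le _ fun n => ?_
    rw [Real.norm_of_nonneg (Finset.sum_nonneg fun k _ => hf0 k), Real.rpow_one,
      Real.norm_of_nonneg n.cast_nonneg]
    refine (Finset.sum_le_sum fun k _ => hf1 k).trans ?_
    simp
  rw [LSeries_eq_mul_integral_of_nonneg f zero_le_one hs hO hf0]
  have hI1 : IntegrableOn (fun x : ℝ => (summatoryRemainder f c x : ℂ) * (x : ℂ) ^ (-(s + 1)))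
      (Set.Ioi 1) := by
    refine Integrable.mono (hint s.re (hσ₀.trans hs)) ?_ ?_
    · exact ((Complex.measurable_ofReal.comp (measurable_summatoryRemainder hf0 c)).mul
        (Complex.measurable_ofReal.pow_const _)).aestronglyMeasurable
    · filter_upwards [ae_restrict_mem measurableSet_Ioi] with x hx
      have hx0 : 0 < x := zero_lt_one.trans hx
      rw [norm_mul, norm_mul, Complex.norm_real, Complex.norm_cpow_eq_rpow_re_of_pos hx0,
        Real.norm_of_nonneg (Real.rpow_nonneg hx0.le _)]
      simp
  have hre : (-s).re < -1 := by simpa using hs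
  have hI2 : IntegrableOn (fun x : ℝ => (c : ℂ) * (x : ℂ) ^ (-s)) (Set.Ioi 1) :=
    (integrableOn_Ioi_cpow_of_lt hre zero_lt_one).const_mul _
  have hsplit : ∫ x in Set.Ioi (1 : ℝ), (∑ k ∈ Finset.Icc 1 ⌊x⌋₊, (f k : ℂ)) * (x : ℂ) ^ (-(s + 1))
      = (∫ x in Set.Ioi (1 : ℝ), (summatoryRemainder f c x : ℂ) * (x : ℂ) ^ (-(s + 1)))
        + ∫ x in Set.Ioi (1 : ℝ), (c : ℂ) * (x : ℂ) ^ (-s) := by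
    rw [← integral_add hI1 hI2]
    refine setIntegral_congr_fun measurableSet_Ioi fun x hx => ?_
    have hx0 : (x : ℂ) ≠ 0 := by exact_mod_cast (zero_lt_one.trans hx).ne'
    have : (x : ℂ) ^ (-s) = x * (x : ℂ) ^ (-(s + 1)) := by
      rw [neg_add, ← sub_eq_add_neg, Complex.cpow_sub _ _ hx0, Complex.cpow_one]
      field_simp
    simp only [this, summatoryRemainder]
    push_cast
    ring
  have hs1 : s - 1 ≠ 0 := by
    intro h
    rw [sub_eq_zero.mp h] at hs
    simp at hs
  have hs1' : -s + 1 ≠ 0 := by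
    intro h
    exact hs1 (by linear_combination -h)
  rw [hsplit, integral_const_mul, integral_Ioi_cpow_of_lt hre zero_lt_one]
  simp only [Complex.ofReal_one, Complex.one_cpow]
  field_simp
  ring

lemma eqOn_of_eqOn_one_lt_re {σ₀ : ℝ} {f g : ℂ → ℂ}
    (hf : DifferentiableOn ℂ f {s | σ₀ < s.re}) (hg : DifferentiableOn ℂ g {s | σ₀ < s.re})
    (h : ∀ s : ℂ, 1 < s.re → f s = g s) : Set.EqOn f g {s | σ₀ < s.re} := by
  have ho : IsOpen {s : ℂ | σ₀ < s.re} := isOpen_lt continuous_const Complex.continuous_re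
  have hpos : (1 : ℝ) < ((|σ₀| + 2 : ℝ) : ℂ).re := by
    rw [Complex.ofReal_re]; linarith [abs_nonneg σ₀]
  refine (hf.analyticOnNhd ho).eqOn_of_preconnected_of_eventuallyEq (hg.analyticOnNhd ho)
    (convex_halfSpace_re_gt σ₀).isPreconnected (z₀ := ((|σ₀| + 2 : ℝ) : ℂ)) ?_ ?_
  · rw [Set.mem_ofPred_eq, Complex.ofReal_re]
    linarith [le_abs_self σ₀]
  · filter_upwards [(isOpen_lt continuous_const Complex.continuous_re).mem_nhds hpos] with s hs
    exact h s hs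

lemma riemannZeta_two_thirds_ne_zero : riemannZeta (2 / 3) ≠ 0 := by
  obtain ⟨g, hg, hgz⟩ := exists_differentiable_eq_sub_one_mul_riemannZeta
  set R := summatoryRemainder (fun _ => 1) 1 with hR
  have hRx : ∀ x : ℝ, R x = ⌊x⌋₊ - x := by simp [hR, summatoryRemainder]
  have hmeas : Measurable R := measurable_summatoryRemainder (fun _ => zero_le_one) 1
  have hint : ∀ σ : ℝ, 0 < σ → IntegrableOn (fun x => R x * x ^ (-(σ + 1))) (Set.Ioi 1) := by
    intro σ hσ
    refine Integrable.mono (integrableOn_Ioi_rpow_of_lt (a := -(σ + 1)) (by linarith) zero_lt_one)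
      (hmeas.mul (measurable_id.pow_const _)).aestronglyMeasurable ?_
    filter_upwards [ae_restrict_mem measurableSet_Ioi] with x hx
    rw [norm_mul]
    refine mul_le_of_le_one_left (norm_nonneg _) ?_
    rw [hRx, Real.norm_eq_abs, abs_le]
    have h1 := Nat.floor_le (zero_lt_one.trans (Set.mem_Ioi.mp hx)).le
    have h2 := Nat.lt_floor_add_one x
    constructor <;> linarith
  have hF := differentiableOn_integral_mul_cpow hmeas hint
  have heq := eqOn_of_eqOn_one_lt_re (σ₀ := 0) (f := g) (g := fun s => s * (s - 1) *
      (∫ x in Set.Ioi (1 : ℝ), (R x : ℂ) * (x : ℂ) ^ (-(s + 1))) + (1 : ℝ) * s)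
    hg.differentiableOn (by fun_prop) fun s hs => by
      have h1 : s ≠ 1 := by rintro rfl; simp at hs
      rw [hgz s h1, ← sub_one_mul_LSeries_eq (fun _ => zero_le_one) (fun _ => le_rfl) zero_lt_one
        hint hs, ← LSeries_one_eq_riemannZeta hs]
      simp only [Complex.ofReal_one]
      rfl
  have h23 := heq (x := 2 / 3) (by norm_num)
  have hreal : ∫ x in Set.Ioi (1 : ℝ), (R x : ℂ) * (x : ℂ) ^ (-((2 / 3 : ℂ) + 1))
      = ((∫ x in Set.Ioi (1 : ℝ), R x * x ^ (-((2 / 3 : ℝ) + 1)) : ℝ) : ℂ) := by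
    rw [← integral_complex_ofReal]
    refine setIntegral_congr_fun measurableSet_Ioi fun x hx => ?_
    rw [Complex.ofReal_mul, Complex.ofReal_cpow (zero_lt_one.trans hx).le]
    norm_num
  have hneg : ∫ x in Set.Ioi (1 : ℝ), R x * x ^ (-((2 / 3 : ℝ) + 1)) ≤ 0 := by
    refine setIntegral_nonpos measurableSet_Ioi fun x hx => ?_
    have hx0 : 0 < x := zero_lt_one.trans hx
    refine mul_nonpos_of_nonpos_of_nonneg ?_ (Real.rpow_nonneg hx0.le _)
    rw [hRx]
    linarith [Nat.floor_le hx0.le]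
  intro h0
  rw [hgz _ (by norm_num), h0, mul_zero] at h23
  simp only [hreal] at h23
  set I := ∫ x in Set.Ioi (1 : ℝ), R x * x ^ (-((2 / 3 : ℝ) + 1))
  have : (0 : ℝ) = 2 / 3 * (2 / 3 - 1) * I + 1 * (2 / 3) := by
    apply Complex.ofReal_injective
    push_cast
    simpa using h23
  linarith

lemma riemannZeta_half_eq_zero_of_integrableOn {c : ℝ} (hint : ∀ σ : ℝ, 1 / 4 < σ → IntegrableOn
      (fun x => summatoryRemainder (fun n => if Squarefree n then 1 else 0) c x * x ^ (-(σ + 1)))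
      (Set.Ioi 1)) {s : ℂ} (hs : 1 / 2 < s.re) (h1 : s ≠ 1) (hz : riemannZeta s = 0) :
    riemannZeta (s / 2) = 0 := by
  obtain ⟨g, hg, hgz⟩ := exists_differentiable_eq_sub_one_mul_riemannZeta
  have hf0 : ∀ n : ℕ, (0 : ℝ) ≤ if Squarefree n then 1 else 0 := fun n => by split_ifs <;> simp
  have hf1 : ∀ n : ℕ, (if Squarefree n then (1 : ℝ) else 0) ≤ 1 := fun n => by split_ifs <;> simp
  have hF := differentiableOn_integral_mul_cpow (measurable_summatoryRemainder hf0 c) hint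
  have hg2 : Differentiable ℂ fun z : ℂ => g (2 * z) := hg.comp (differentiable_id.const_mul 2)
  have heq := eqOn_of_eqOn_one_lt_re (σ₀ := 1 / 4) (f := fun z => (2 * z - 1) * g z)
    (g := fun z => (z * (z - 1) * (∫ x in Set.Ioi (1 : ℝ),
      (summatoryRemainder (fun n => if Squarefree n then 1 else 0) c x : ℂ)
        * (x : ℂ) ^ (-(z + 1))) + c * z) * g (2 * z))
    (by fun_prop) (by fun_prop) fun z hz => by
      have hz1 : z ≠ 1 := by rintro rfl; simp at hz
      have hz2 : 2 * z ≠ 1 := by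
        intro h
        have := congrArg Complex.re h
        simp at this
        linarith
      rw [hgz z hz1, hgz _ hz2, ← sub_one_mul_LSeries_eq hf0 hf1 (by norm_num) hint hz,
        ← LSeries_squarefree_mul_riemannZeta hz]
      ring
  have h2 : (2 : ℂ) * (s / 2) = s := by ring
  have hre : (s / 2).re = s.re / 2 := by simp
  have hs2 := heq (x := s / 2) (by rw [Set.mem_ofPred_eq, hre]; linarith)
  have hs21 : s / 2 ≠ 1 := by
    intro h
    have h' : s = 2 := by linear_combination 2 * h
    rw [h'] at hz
    exact riemannZeta_ne_zero_of_one_le_re (by norm_num) hz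
  simp only [h2] at hs2
  rw [hgz s h1, hz, hgz _ hs21, mul_zero, mul_zero, mul_eq_zero, mul_eq_zero] at hs2
  rcases hs2 with h | h | h
  · exact absurd (sub_eq_zero.mp h) h1
  · exact absurd (sub_eq_zero.mp h) hs21
  · exact h

lemma integrableOn_mul_rpow_of_dyadic_bound {R : ℝ → ℝ} {C θ σ : ℝ}
    (hmeas : ∀ a b, IntervalIntegrable R volume a b) (hσ : 0 < σ + 1) (hθ : θ < σ + 1)
    (hC : ∀ k : ℕ, ∫ x in (2 : ℝ) ^ k..2 ^ (k + 1), |R x| ≤ C * ((2 : ℝ) ^ θ) ^ k) :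
    IntegrableOn (fun x => R x * x ^ (-(σ + 1))) (Set.Ioi 1) := by
  set f : ℝ → ℝ := fun x => R x * x ^ (-(σ + 1)) with hf
  have hpow1 : ∀ k : ℕ, (1 : ℝ) ≤ 2 ^ k := fun k => one_le_pow₀ one_le_two
  have hle : ∀ k : ℕ, (2 : ℝ) ^ k ≤ 2 ^ (k + 1) := fun k =>
    pow_le_pow_right₀ one_le_two k.le_succ
  have hfint : ∀ a b : ℝ, 1 ≤ a → a ≤ b → IntervalIntegrable f volume a b := by
    intro a b ha hab
    refine (hmeas a b).mul_continuousOn fun x hx => ?_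
    rw [Set.uIcc_of_le hab] at hx
    exact (Real.continuousAt_rpow_const _ _
      (Or.inl (by linarith [hx.1] : (0 : ℝ) < x).ne')).continuousWithinAt
  set q : ℝ := 2 ^ θ * 2 ^ (-(σ + 1)) with hq
  have hq0 : 0 ≤ q := by positivity
  have hq1 : q < 1 := by
    rw [hq, ← Real.rpow_add two_pos]
    exact Real.rpow_lt_one_of_one_lt_of_neg one_lt_two (by linarith)
  have hC0 : 0 ≤ C := by
    have h := hC 0
    rw [pow_zero, pow_zero, mul_one] at h
    refine le_trans (intervalIntegral.integral_nonneg (by norm_num) fun x _ => abs_nonneg _) h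
  have hblock : ∀ k : ℕ, ∫ x in (2 : ℝ) ^ k..2 ^ (k + 1), ‖f x‖ ≤ C * q ^ k := by
    intro k
    have hk0 : (0 : ℝ) < 2 ^ k := by positivity
    calc ∫ x in (2 : ℝ) ^ k..2 ^ (k + 1), ‖f x‖
        ≤ ∫ x in (2 : ℝ) ^ k..2 ^ (k + 1), |R x| * ((2 : ℝ) ^ k) ^ (-(σ + 1)) := by
          refine intervalIntegral.integral_mono_on (hle k) (hfint _ _ (hpow1 k) (hle k)).norm
            ((hmeas _ _).abs.mul_const _) fun x hx => ?_
          have hx0 : 0 < x := hk0.trans_le hx.1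
          rw [hf, norm_mul, Real.norm_eq_abs, Real.norm_of_nonneg (Real.rpow_nonneg hx0.le _)]
          exact mul_le_mul_of_nonneg_left
            (Real.rpow_le_rpow_of_nonpos hk0 hx.1 (by linarith)) (abs_nonneg _)
      _ = (∫ x in (2 : ℝ) ^ k..2 ^ (k + 1), |R x|) * ((2 : ℝ) ^ k) ^ (-(σ + 1)) :=
          intervalIntegral.integral_mul_const _ _
      _ ≤ C * ((2 : ℝ) ^ θ) ^ k * ((2 : ℝ) ^ k) ^ (-(σ + 1)) :=
          mul_le_mul_of_nonneg_right (hC k) (Real.rpow_nonneg hk0.le _)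
      _ = C * q ^ k := by
          rw [hq, mul_pow, ← Real.rpow_natCast_mul two_pos.le, mul_comm (k : ℝ),
            Real.rpow_mul_natCast two_pos.le, mul_assoc]
  refine integrableOn_Ioi_of_intervalIntegral_norm_bounded (C * (1 - q)⁻¹) 1
    (b := fun n : ℕ => (2 : ℝ) ^ n) (l := Filter.atTop) (fun n => ?_)
    (tendsto_pow_atTop_atTop_of_one_lt one_lt_two) (Filter.Eventually.of_forall fun n => ?_)
  · exact (intervalIntegrable_iff_integrableOn_Ioc_of_le (hpow1 n)).mp
      (hfint _ _ le_rfl (hpow1 n))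
  · have hsum := intervalIntegral.sum_integral_adjacent_intervals (f := fun x => ‖f x‖)
      (μ := volume) (a := fun k : ℕ => (2 : ℝ) ^ k) (n := n)
      fun k _ => (hfint _ _ (hpow1 k) (hle k)).norm
    rw [pow_zero] at hsum
    rw [← hsum]
    calc _ ≤ ∑ k ∈ Finset.range n, C * q ^ k := Finset.sum_le_sum fun k _ => hblock k
      _ = C * ∑ k ∈ Finset.range n, q ^ k := by rw [Finset.mul_sum]
      _ ≤ C * (1 - q)⁻¹ := by
        refine mul_le_mul_of_nonneg_left ?_ hC0
        rw [← tsum_geometric_of_lt_one hq0 hq1]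
        exact (summable_geometric_of_lt_one hq0 hq1).sum_le_tsum _ fun k _ => pow_nonneg hq0 k

lemma le_mul_pow_of_le_two_mul_add {A : ℕ → ℝ} {D t : ℝ} (ht : 2 < t)
    (hA : ∀ k, A (k + 1) ≤ 2 * A k + D * t ^ k) : ∃ C, ∀ k, A k ≤ C * t ^ k := by
  refine ⟨max (A 0) (D / (t - 2)), fun k => ?_⟩
  have hD : D ≤ max (A 0) (D / (t - 2)) * (t - 2) := by
    rw [← div_le_iff₀ (sub_pos.mpr ht)]
    exact le_max_right _ _
  induction k with
  | zero => simp
  | succ k ih =>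
    have htk : (0 : ℝ) ≤ t ^ k := by positivity
    have := mul_le_mul_of_nonneg_right hD htk
    calc A (k + 1) ≤ 2 * A k + D * t ^ k := hA k
      _ ≤ 2 * (max (A 0) (D / (t - 2)) * t ^ k) + max (A 0) (D / (t - 2)) * (t - 2) * t ^ k := by
        linarith
      _ = _ := by ring

lemma intervalIntegrable_shift_sub {R : ℝ → ℝ}
    (hR : ∀ a b, IntervalIntegrable R volume a b)
    (h a b : ℝ) :
    IntervalIntegrable (fun x => R (x + h) - R x) volume a b := by
  refine IntervalIntegrable.sub ?_ (hR a b)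
  simpa using (hR (a + h) (b + h)).comp_add_right h

lemma integral_abs_shift_mul_le {R : ℝ → ℝ}
    (hR : ∀ a b, IntervalIntegrable R volume a b)
    {X H : ℝ} (hX : 0 ≤ X) (hH : 0 ≤ H) (m : ℕ)
    (hm : m * H ≤ 2 * X) :
    ∫ x in X..2 * X, |R (x + m * H) - R x|
      ≤ m * ∫ x in X..4 * X, |R (x + H) - R x| := by
  induction m with
  | zero => simp
  | succ m ih =>
    push_cast at hm ⊢
    have hmH : (0 : ℝ) ≤ m * H := by positivity
    have hd := fun a b => (intervalIntegrable_shift_sub hR H a b).abs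
    have hm' : m * H ≤ 2 * X := by linarith
    have hshift : ∫ x in X..2 * X, |R (x + m * H + H) - R (x + m * H)|
        ≤ ∫ x in X..4 * X, |R (x + H) - R x| := by
      rw [intervalIntegral.integral_comp_add_right (fun x => |R (x + H) - R x|)]
      refine intervalIntegral.integral_mono_interval (by linarith) (by linarith) (by linarith)
        (Filter.Eventually.of_forall fun x => abs_nonneg _) (hd _ _)
    have hi : IntervalIntegrable (fun x => |R (x + m * H + H) - R (x + m * H)|)
        volume X (2 * X) := by
      simpa using (hd (X + m * H) (2 * X + m * H)).comp_add_right (m * H)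
    have hi' := (intervalIntegrable_shift_sub hR (m * H) X (2 * X)).abs
    calc ∫ x in X..2 * X, |R (x + (m + 1) * H) - R x|
        ≤ ∫ x in X..2 * X, (|R (x + m * H + H) - R (x + m * H)| + |R (x + m * H) - R x|) := by
          refine intervalIntegral.integral_mono_on (by linarith)
            (intervalIntegrable_shift_sub hR _ _ _).abs (hi.add hi') fun x _ => ?_
          rw [show x + (m + 1) * H = x + m * H + H by ring]
          exact abs_sub_le _ _ _
      _ = _ := intervalIntegral.integral_add hi hi'
      _ ≤ _ := by linarith [ih hm']

lemma integral_abs_double_le {R : ℝ → ℝ}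
    (hR : ∀ a b, IntervalIntegrable R volume a b)
    {X : ℝ} (hX : 0 ≤ X) :
    ∫ x in 2 * X..4 * X, |R x| ≤ 2 * (∫ x in X..2 * X, |R x|)
      + (∫ x in X..2 * X, |R (x + X) - R x|) + ∫ x in X..2 * X, |R (x + 2 * X) - R x| := by
  have hRa := fun a b => (hR a b).abs
  have hbound : ∀ h : ℝ, ∫ x in X + h..2 * X + h, |R x|
      ≤ (∫ x in X..2 * X, |R x|) + ∫ x in X..2 * X, |R (x + h) - R x| := by
    intro h
    have hd := (intervalIntegrable_shift_sub hR h X (2 * X)).abs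
    rw [← intervalIntegral.integral_comp_add_right (fun x => |R x|),
      ← intervalIntegral.integral_add (hRa _ _) hd]
    refine intervalIntegral.integral_mono_on (by linarith) ?_ ((hRa _ _).add hd) fun x _ => ?_
    · simpa using (hRa (X + h) (2 * X + h)).comp_add_right h
    · calc |R (x + h)| = |R x + (R (x + h) - R x)| := by ring_nf
        _ ≤ _ := abs_add_le _ _
  rw [← intervalIntegral.integral_add_adjacent_intervals (hRa (2 * X) (3 * X))
    (hRa (3 * X) (4 * X))]
  have h1 := hbound X
  have h2 := hbound (2 * X)
  rw [show X + X = 2 * X by ring, show 2 * X + X = 3 * X by ring] at h1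
  rw [show X + 2 * X = 3 * X by ring, show 2 * X + 2 * X = 4 * X by ring] at h2
  linarith

/-- If the increments of `R` over short intervals are small in mean, then `R` itself is small in
mean over dyadic intervals. -/
lemma exists_dyadic_bound_of_increment_bound {R : ℝ → ℝ}
    (hR : ∀ a b, IntervalIntegrable R volume a b)
    {B ε τ : ℝ} (hB : 0 ≤ B) (hε0 : 0 < ε) (hε1 : ε ≤ 1)
    (hτ : 0 < τ)
    (hinc : ∀ X H : ℝ, 1 ≤ X → 1 ≤ H → H ≤ X ^ (1 - ε) →
      ∫ x in X..2 * X, |R (x + H) - R x| ≤ B * X * H ^ τ) :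
    ∃ C, ∀ k : ℕ, ∫ x in (2 : ℝ) ^ k..2 ^ (k + 1), |R x| ≤ C * ((2 : ℝ) ^ (1 + ε + τ)) ^ k := by
  have ht : (2 : ℝ) < 2 ^ (1 + ε + τ) := by
    conv_lhs => rw [← Real.rpow_one 2]
    exact Real.rpow_lt_rpow_of_exponent_lt one_lt_two (by linarith)
  refine le_mul_pow_of_le_two_mul_add (D := 18 * B) ht fun k => ?_
  set X : ℝ := 2 ^ k with hX
  have hX1 : 1 ≤ X := one_le_pow₀ one_le_two
  have hX0 : 0 < X := by linarith
  set N : ℕ := ⌈X ^ ε⌉₊ with hN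
  have hXε1 : 1 ≤ X ^ ε := Real.one_le_rpow hX1 hε0.le
  have hNlo : X ^ ε ≤ N := Nat.le_ceil _
  have hN1 : (1 : ℝ) ≤ N := hXε1.trans hNlo
  have hN0 : (0 : ℝ) < N := by linarith
  have hNhi : (N : ℝ) ≤ 2 * X ^ ε := by
    have := Nat.ceil_lt_add_one (zero_le_one.trans hXε1)
    linarith
  have hNX : (N : ℝ) ≤ X := by
    have hle : N ≤ 2 ^ k := by
      refine Nat.ceil_le.mpr ?_
      push_cast
      calc X ^ ε ≤ X ^ (1 : ℝ) := Real.rpow_le_rpow_of_exponent_le hX1 hε1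
        _ = 2 ^ k := by rw [Real.rpow_one]
    rw [hX]
    exact_mod_cast hle
  set H : ℝ := X / N with hH
  have hNH : N * H = X := by rw [hH]; field_simp
  have hH1 : 1 ≤ H := by rwa [hH, le_div_iff₀ hN0, one_mul]
  have hHX : H ≤ X ^ (1 - ε) := by
    rw [Real.rpow_sub hX0, Real.rpow_one, hH]
    exact div_le_div_of_nonneg_left hX0.le (by linarith) hNlo
  have hH2X : H ≤ (2 * X) ^ (1 - ε) :=
    hHX.trans (Real.rpow_le_rpow hX0.le (by linarith) (by linarith))
  have hHX' : H ≤ X := div_le_self hX0.le hN1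
  have hI1 := hinc X H hX1 hH1 hHX
  have hI2 := hinc (2 * X) H (by linarith) hH1 hH2X
  have hd := fun a b => (intervalIntegrable_shift_sub hR H a b).abs
  have hI : ∫ x in X..4 * X, |R (x + H) - R x| ≤ 3 * (B * X * X ^ τ) := by
    rw [← intervalIntegral.integral_add_adjacent_intervals (hd X (2 * X)) (hd (2 * X) (4 * X))]
    rw [show 2 * (2 * X) = 4 * X by ring] at hI2
    have hτX : B * X * H ^ τ ≤ B * X * X ^ τ := by gcongr
    linarith
  have hs1 := integral_abs_shift_mul_le hR hX0.le (zero_le_one.trans hH1) N (by rw [hNH]; linarith)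
  have hs2 := integral_abs_shift_mul_le hR hX0.le (zero_le_one.trans hH1) (2 * N)
    (by push_cast; rw [mul_assoc, hNH])
  rw [hNH] at hs1
  push_cast at hs2
  rw [mul_assoc, hNH] at hs2
  have hdbl := integral_abs_double_le hR hX0.le
  have hNI : N * ∫ x in X..4 * X, |R (x + H) - R x| ≤ 6 * (B * (X ^ ε * X * X ^ τ)) := by
    calc N * ∫ x in X..4 * X, |R (x + H) - R x| ≤ N * (3 * (B * X * X ^ τ)) := by gcongr
      _ ≤ (2 * X ^ ε) * (3 * (B * X * X ^ τ)) := by gcongr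
      _ = _ := by ring
  have hpow : X ^ ε * X * X ^ τ = ((2 : ℝ) ^ (1 + ε + τ)) ^ k := by
    rw [← Real.rpow_mul_natCast two_pos.le, mul_comm _ (k : ℝ), Real.rpow_natCast_mul two_pos.le,
      ← hX, Real.rpow_add hX0, Real.rpow_add hX0, Real.rpow_one]
    ring
  rw [hpow] at hNI
  rw [show (2 : ℝ) ^ (k + 1) = 2 * X by rw [hX]; ring,
    show (2 : ℝ) ^ (k + 1 + 1) = 4 * X by rw [hX]; ring]
  linarith

lemma sqfShort_sub_eq (c x : ℝ) {H : ℝ} (hH : 0 ≤ H) :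
    sqfShort x H - c * H =
      summatoryRemainder (fun n => if Squarefree n then 1 else 0) c (x + H)
        - summatoryRemainder (fun n => if Squarefree n then 1 else 0) c x := by
  have hIcc : ∀ n : ℕ, Finset.Icc 1 n = Finset.Ioc 0 n := fun n => by
    ext; simp [Nat.succ_le_iff]
  have h := Finset.sum_Ioc_consecutive (fun n : ℕ => if Squarefree n then (1 : ℝ) else 0)
    (Nat.zero_le ⌊x⌋₊) (Nat.floor_le_floor (le_add_of_nonneg_right hH : x ≤ x + H))
  simp only [summatoryRemainder, sqfShort, hIcc]
  linarith

lemma intervalIntegral_abs_le_of_sq_le {d : ℝ → ℝ} {a b V l : ℝ} (hab : a ≤ b) (hl : 0 < l)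
    (hd : IntervalIntegrable d volume a b) (hd2 : IntervalIntegrable (fun x => d x ^ 2) volume a b)
    (hV : ∫ x in a..b, d x ^ 2 ≤ V) :
    ∫ x in a..b, |d x| ≤ (V / l + (b - a) * l) / 2 := by
  calc ∫ x in a..b, |d x| ≤ ∫ x in a..b, (d x ^ 2 * (1 / (2 * l)) + l / 2) := by
        refine intervalIntegral.integral_mono_on hab hd.abs
          ((hd2.mul_const _).add intervalIntegrable_const) fun x _ => ?_
        have h : d x ^ 2 * (1 / (2 * l)) + l / 2 - |d x| = (|d x| - l) ^ 2 / (2 * l) := by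
          rw [← sq_abs (d x)]
          field_simp
          ring
        have : 0 ≤ (|d x| - l) ^ 2 / (2 * l) := by positivity
        linarith
    _ = (∫ x in a..b, d x ^ 2) * (1 / (2 * l)) + (b - a) * (l / 2) := by
        rw [intervalIntegral.integral_add (hd2.mul_const _) intervalIntegrable_const,
          intervalIntegral.integral_mul_const, intervalIntegral.integral_const, smul_eq_mul]
    _ ≤ V * (1 / (2 * l)) + (b - a) * (l / 2) := by gcongr
    _ = _ := by field_simp

lemma abs_summatoryRemainder_le {f : ℕ → ℝ} (hf0 : ∀ n, 0 ≤ f n) (hf1 : ∀ n, f n ≤ 1) (c : ℝ)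
    {x : ℝ} (hx : 0 ≤ x) : |summatoryRemainder f c x| ≤ (1 + |c|) * x := by
  have h0 : 0 ≤ ∑ k ∈ Finset.Icc 1 ⌊x⌋₊, f k := Finset.sum_nonneg fun k _ => hf0 k
  have h1 : ∑ k ∈ Finset.Icc 1 ⌊x⌋₊, f k ≤ x := by
    refine (Finset.sum_le_sum fun k _ => hf1 k).trans ?_
    simpa using Nat.floor_le hx
  calc |summatoryRemainder f c x| ≤ |∑ k ∈ Finset.Icc 1 ⌊x⌋₊, f k| + |c * x| := abs_sub _ _
    _ ≤ x + |c| * x := by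
      rw [abs_of_nonneg h0, abs_mul, abs_of_nonneg hx]
      linarith
    _ = _ := by ring

lemma intervalIntegrable_summatoryRemainder_shift_sub_sq {f : ℕ → ℝ} (hf0 : ∀ n, 0 ≤ f n)
    (hf1 : ∀ n, f n ≤ 1) (c : ℝ) {H a b : ℝ} (hH : 0 ≤ H) (ha : 0 ≤ a) (hab : a ≤ b) :
    IntervalIntegrable
      (fun x => (summatoryRemainder f c (x + H) - summatoryRemainder f c x) ^ 2) volume a b := by
  rw [intervalIntegrable_iff_integrableOn_Ioc_of_le hab]
  have hm := measurable_summatoryRemainder hf0 c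
  refine Measure.integrableOn_of_bounded (M := (2 * ((1 + |c|) * (b + H))) ^ 2)
    measure_Ioc_lt_top.ne
    (((hm.comp (measurable_id.add_const H)).sub hm).pow_const 2).aestronglyMeasurable ?_
  filter_upwards [ae_restrict_mem measurableSet_Ioc] with x hx
  have hx0 : 0 ≤ x := ha.trans hx.1.le
  have hc : 0 ≤ 1 + |c| := by positivity
  have h1 := abs_summatoryRemainder_le hf0 hf1 c (add_nonneg hx0 hH)
  have h2 := abs_summatoryRemainder_le hf0 hf1 c hx0
  have h3 : (1 + |c|) * (x + H) ≤ (1 + |c|) * (b + H) :=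
    mul_le_mul_of_nonneg_left (by linarith [hx.2]) hc
  have h4 : (1 + |c|) * x ≤ (1 + |c|) * (b + H) :=
    mul_le_mul_of_nonneg_left (by linarith [hx.2]) hc
  rw [norm_pow, Real.norm_eq_abs]
  refine pow_le_pow_left₀ (abs_nonneg _) ((abs_sub _ _).trans ?_) 2
  linarith

theorem variance_upper_bound_implies_RH
    (hbound : ∀ ε : ℝ, ε ∈ Set.Ioo (0 : ℝ) (1 / 100) →
      ∀ δ : ℝ, 0 < δ →
        ∃ K : ℝ, 0 < K ∧
          ∀ X H : ℝ, 1 ≤ X → 1 ≤ H → H ≤ X ^ (1 - ε : ℝ) →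
            (1 / X) * (∫ x in X..(2 * X), |sqfShort x H - 6 * H / Real.pi ^ 2| ^ 2)
              ≤ K * H ^ ((1 : ℝ) / 2 + δ)) :
    RiemannHypothesis := by
  have hf0 : ∀ n : ℕ, (0 : ℝ) ≤ if Squarefree n then 1 else 0 := fun n => by split_ifs <;> simp
  have hf1 : ∀ n : ℕ, (if Squarefree n then (1 : ℝ) else 0) ≤ 1 := fun n => by split_ifs <;> simp
  set c : ℝ := 6 / Real.pi ^ 2 with hc
  have hR := intervalIntegrable_summatoryRemainder hf0 c
  refine riemannHypothesis_of_half_zero riemannZeta_two_thirds_ne_zero fun s hs h1 hz =>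
    riemannZeta_half_eq_zero_of_integrableOn (c := c) (fun σ hσ => ?_) hs h1 hz
  set η : ℝ := min (1 / 200) ((σ - 1 / 4) / 2) with hη
  have hη0 : 0 < η := lt_min (by norm_num) (by linarith)
  have hη1 : η ≤ 1 / 200 := min_le_left _ _
  have hη2 : η ≤ (σ - 1 / 4) / 2 := min_le_right _ _
  obtain ⟨K, hK, hvar⟩ := hbound η ⟨hη0, by linarith⟩ η hη0
  obtain ⟨C, hC⟩ := exists_dyadic_bound_of_increment_bound hR (B := (K + 1) / 2) (ε := η)
    (τ := 1 / 4 + η / 2) (by linarith) hη0 (by linarith) (by linarith) fun X H hX hH hHX => by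
      have hX0 : 0 < X := by linarith
      have hH0 : 0 < H := by linarith
      have hv := hvar X H hX hH hHX
      have heq : ∀ x, |sqfShort x H - 6 * H / Real.pi ^ 2| ^ 2 =
          (summatoryRemainder (fun n => if Squarefree n then 1 else 0) c (x + H)
            - summatoryRemainder (fun n => if Squarefree n then 1 else 0) c x) ^ 2 := by
        intro x
        rw [sq_abs, ← sqfShort_sub_eq c x hH0.le, hc]
        ring
      simp only [heq] at hv
      rw [one_div, inv_mul_le_iff₀ hX0] at hv
      have hl : 0 < H ^ (1 / 4 + η / 2) := Real.rpow_pos_of_pos hH0 _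
      have hl2 : H ^ (1 / 2 + η) = H ^ (1 / 4 + η / 2) * H ^ (1 / 4 + η / 2) := by
        rw [← Real.rpow_add hH0]
        ring_nf
      refine (intervalIntegral_abs_le_of_sq_le (by linarith) hl
        (intervalIntegrable_shift_sub hR H _ _)
        (intervalIntegrable_summatoryRemainder_shift_sub_sq hf0 hf1 c hH0.le hX0.le
          (by linarith)) hv).trans (le_of_eq ?_)
      rw [hl2]
      field_simp
      ring
  exact integrableOn_mul_rpow_of_dyadic_bound hR (by linarith) (by linarith) hC
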